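/- Let w₀ ∈ D be a base point and fix holomorphic functions ψ₁, ψ₂, ψ₃ : D → ℂ with ψ₁' = (1 − c·G²)·F, ψ₂' = −i·(1 + c·G²)·F, ψ₃' = 2·G·F and ψ₁(w₀) = ψ₂(w₀) = ψ₃(w₀) = 0, so that X(c) := (Re ψ₁, Re ψ₂, Re ψ₃) : D → ℝ³ is the zero mean curvature surface in ℝ³(c) with Weierstrass data (F, G). Fix also holomorphic χ₁, χ₂, χ₃ : D → ℂ with χ₁' = i·(1 + c·G²)·F, χ₂' = (1 − c·G²)·F, χ₃' = 2·i·G·F and χ₁(w₀) = χ₂(w₀) = χ₃(w₀) = 0, so that X*(−c) := (Re χ₁, Re χ₂, Re χ₃) is the conjugate surface of X(−c) in ℝ³(−c). Then the dual surface X^d(c) := (Re ψ₁, Re ψ₂, −Im ψ₃) of X(c) satisfies, for every w ∈ D, the componentwise identity X^d(c)(w) = (Re χ₂(w), −Re χ₁(w), Re χ₃(w)); that is, X^d(c) is obtained from X*(−c) by a rotation by angle π/2 in the xy-plane. -/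

import Mathlib

open Complex Set

/-- Two functions with the same derivative on a connected open set that agree at one point
agree on the whole set. -/
theorem eqOn_of_hasDerivAt_of_isPreconnected {D : Set ℂ} (hD : IsOpen D)
    (hconn : IsPreconnected D) {f g f' : ℂ → ℂ} (hf : ∀ w ∈ D, HasDerivAt f (f' w) w)
    (hg : ∀ w ∈ D, HasDerivAt g (f' w) w) {w₀ : ℂ} (hw₀ : w₀ ∈ D) (h₀ : f w₀ = g w₀) :
    EqOn f g D :=
  hD.eqOn_of_deriv_eq hconn
    (fun w hw => (hf w hw).differentiableAt.differentiableWithinAt)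
    (fun w hw => (hg w hw).differentiableAt.differentiableWithinAt)
    (fun w hw => (hf w hw).deriv.trans (hg w hw).deriv.symm) hw₀ h₀

/-- The dual surface `X^d(c)` coincides, up to the rotation by angle π/2
in the xy-plane, with the conjugate surface `X*(-c)`. -/
theorem dual_eq_rotated_conjugate
    (D : Set ℂ) (hD : IsOpen D) (hne : D.Nonempty) (hconn : IsConnected D)
    (hsc : SimplyConnectedSpace D) (hproper : D ≠ univ)
    (F G : ℂ → ℂ) (hF : DifferentiableOn ℂ F D) (hG : DifferentiableOn ℂ G D)
    (hFnz : ¬ ∀ w ∈ D, F w = 0)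
    (c : ℝ) (w₀ : ℂ) (hw₀ : w₀ ∈ D)
    (ψ₁ ψ₂ ψ₃ χ₁ χ₂ χ₃ : ℂ → ℂ)
    (hψ₁ : ∀ w ∈ D, HasDerivAt ψ₁ ((1 - (c : ℂ) * (G w) ^ 2) * F w) w)
    (hψ₂ : ∀ w ∈ D, HasDerivAt ψ₂ (-I * (1 + (c : ℂ) * (G w) ^ 2) * F w) w)
    (hψ₃ : ∀ w ∈ D, HasDerivAt ψ₃ (2 * G w * F w) w)
    (hψ₁₀ : ψ₁ w₀ = 0) (hψ₂₀ : ψ₂ w₀ = 0) (hψ₃₀ : ψ₃ w₀ = 0)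
    (hχ₁ : ∀ w ∈ D, HasDerivAt χ₁ (I * (1 + (c : ℂ) * (G w) ^ 2) * F w) w)
    (hχ₂ : ∀ w ∈ D, HasDerivAt χ₂ ((1 - (c : ℂ) * (G w) ^ 2) * F w) w)
    (hχ₃ : ∀ w ∈ D, HasDerivAt χ₃ (2 * I * G w * F w) w)
    (hχ₁₀ : χ₁ w₀ = 0) (hχ₂₀ : χ₂ w₀ = 0) (hχ₃₀ : χ₃ w₀ = 0) :
    ∀ w ∈ D,
      (ψ₁ w).re = (χ₂ w).re ∧
      (ψ₂ w).re = -(χ₁ w).re ∧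
      -(ψ₃ w).im = (χ₃ w).re := by
  have h₁ : EqOn ψ₁ χ₂ D :=
    eqOn_of_hasDerivAt_of_isPreconnected hD hconn.isPreconnected hψ₁ hχ₂ hw₀
      (hψ₁₀.trans hχ₂₀.symm)
  have h₂ : EqOn ψ₂ (fun w => -χ₁ w) D :=
    eqOn_of_hasDerivAt_of_isPreconnected hD hconn.isPreconnected hψ₂
      (fun w hw => (hχ₁ w hw).fun_neg.congr_deriv (by ring)) hw₀ (by simp [hψ₂₀, hχ₁₀])
  have h₃ : EqOn χ₃ (fun w => I * ψ₃ w) D :=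
    eqOn_of_hasDerivAt_of_isPreconnected hD hconn.isPreconnected hχ₃
      (fun w hw => ((hψ₃ w hw).const_mul I).congr_deriv (by ring)) hw₀ (by simp [hψ₃₀, hχ₃₀])
  intro w hw
  simp [h₁ hw, h₂ hw, h₃ hw]
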